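/- arXiv:math/0101138 — 4 statements merged into one kernel-verified Lean document; each statement's English description precedes it below -/
import Mathlib

section
/- Let R be a real number and let b, c : ℝ → ℝ be C^∞ functions satisfying b(R) = c(R) and b′(R) = c′(R). Then there exist, for every ε > 0, a C^∞ function a_ε : ℝ → ℝ and a real number δ(ε) > 0, with δ(ε) → 0 as ε → 0⁺, such that: (1) a_ε(r) = b(r) for all r ≤ R − δ(ε) and a_ε(r) = c(r) for all r ≥ R; and (2) the infimum of a_ε″ over the interval [R − δ(ε), R] tends to min{b″(R), c″(R)} and the supremum of a_ε″ over [R − δ(ε), R] tends to max{b″(R), c″(R)} as ε → 0⁺. -/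
open Filter Set

lemma aux_bdd : ∃ M : ℝ, 0 ≤ M ∧ (∀ x, |deriv Real.smoothTransition x| ≤ M) ∧
    (∀ x, |deriv (deriv Real.smoothTransition) x| ≤ M) := by
  have hs : ContDiff ℝ (⊤ : ℕ∞) Real.smoothTransition := Real.smoothTransition.contDiff
  have hs1 : ContDiff ℝ (⊤ : ℕ∞) (deriv Real.smoothTransition) :=
    (contDiff_infty_iff_deriv.1 hs).2
  have hs2 : ContDiff ℝ (⊤ : ℕ∞) (deriv (deriv Real.smoothTransition)) :=
    (contDiff_infty_iff_deriv.1 hs1).2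
  have hc : HasCompactSupport (deriv Real.smoothTransition) := by
    refine HasCompactSupport.intro (isCompact_Icc (a := (0:ℝ)) (b := 1)) ?_
    intro x hx
    rw [mem_Icc, not_and_or, not_le, not_le] at hx
    rcases hx with hx | hx
    · have : Real.smoothTransition =ᶠ[nhds x] fun _ => (0:ℝ) := by
        filter_upwards [Iio_mem_nhds hx] with y hy
        exact Real.smoothTransition.zero_of_nonpos (le_of_lt hy)
      rw [this.deriv_eq]; simp
    · have : Real.smoothTransition =ᶠ[nhds x] fun _ => (1:ℝ) := by
        filter_upwards [Ioi_mem_nhds hx] with y hy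
        exact Real.smoothTransition.one_of_one_le (le_of_lt hy)
      rw [this.deriv_eq]; simp
  obtain ⟨A, hA⟩ := hs1.continuous.bounded_above_of_compact_support hc
  obtain ⟨B, hB⟩ := hs2.continuous.bounded_above_of_compact_support hc.deriv
  refine ⟨max A B, ?_, fun x => (hA x).trans (le_max_left _ _),
    fun x => (hB x).trans (le_max_right _ _)⟩
  exact (norm_nonneg _).trans ((hA 0).trans (le_max_left _ _))

lemma aux_taylor (R : ℝ) (f : ℝ → ℝ) (hf : ContDiff ℝ (⊤ : ℕ∞) f)
    (h0 : f R = 0) (h1 : deriv f R = 0) : ∃ K : ℝ, 0 ≤ K ∧ ∀ r ∈ Icc (R - 1) R,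
      |deriv f r| ≤ K * (R - r) ∧ |f r| ≤ K * (R - r) ^ 2 := by
  have hs1 : ContDiff ℝ (⊤ : ℕ∞) (deriv f) := (contDiff_infty_iff_deriv.1 hf).2
  have hs2 : ContDiff ℝ (⊤ : ℕ∞) (deriv (deriv f)) := (contDiff_infty_iff_deriv.1 hs1).2
  obtain ⟨K, hK⟩ := (isCompact_Icc (a := R - 1) (b := R)).exists_bound_of_continuousOn
    hs2.continuous.continuousOn
  have hK0 : 0 ≤ K := (norm_nonneg _).trans (hK R ⟨by linarith, le_rfl⟩)
  have d1 : ∀ r ∈ Icc (R - 1) R, |deriv f r| ≤ K * (R - r) := by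
    intro r hr
    have := (convex_Icc (R-1) R).norm_image_sub_le_of_norm_deriv_le (f := deriv f)
      (fun x _ => (hs1.differentiable (by simp)).differentiableAt) hK
      (x := R) (y := r) ⟨by linarith, le_rfl⟩ hr
    rw [h1, sub_zero, Real.norm_eq_abs, Real.norm_eq_abs, abs_sub_comm,
      abs_of_nonneg (sub_nonneg.2 hr.2)] at this
    exact this
  refine ⟨K, hK0, fun r hr => ⟨d1 r hr, ?_⟩⟩
  have := (convex_Icc r R).norm_image_sub_le_of_norm_deriv_le (f := f) (C := K * (R - r))
      (fun x _ => (hf.differentiable (by simp)).differentiableAt)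
      (fun x hx => (d1 x ⟨hr.1.trans hx.1, hx.2⟩).trans
        (mul_le_mul_of_nonneg_left (by linarith [hx.1]) hK0))
      (x := R) (y := r) ⟨hr.2, le_rfl⟩ ⟨le_rfl, hr.2⟩
  rw [h0, sub_zero, Real.norm_eq_abs, Real.norm_eq_abs, abs_sub_comm,
      abs_of_nonneg (sub_nonneg.2 hr.2)] at this
  rw [pow_two, ← mul_assoc]
  exact this

lemma aux_ext (S : Set ℝ) (B C e : ℝ) (hS : ∀ x ∈ S, min B C - e ≤ x ∧ x ≤ max B C + e)
    (x y : ℝ) (hx : x ∈ S) (hy : y ∈ S) (hxB : |x - B| ≤ e) (hyC : |y - C| ≤ e) :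
    |sInf S - min B C| ≤ e ∧ |sSup S - max B C| ≤ e := by
  have hbb : BddBelow S := ⟨_, fun z hz => (hS z hz).1⟩
  have hba : BddAbove S := ⟨_, fun z hz => (hS z hz).2⟩
  have i1 := csInf_le hbb hx
  have i2 := csInf_le hbb hy
  have s1 := le_csSup hba hx
  have s2 := le_csSup hba hy
  have i3 : min B C - e ≤ sInf S := le_csInf ⟨x, hx⟩ fun z hz => (hS z hz).1
  have s3 : sSup S ≤ max B C + e := csSup_le ⟨x, hx⟩ fun z hz => (hS z hz).2
  rw [abs_le] at *
  rw [abs_le]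
  rcases le_total B C with h | h
  · rw [min_eq_left h] at *; rw [max_eq_right h] at *
    refine ⟨⟨?_, ?_⟩, ?_, ?_⟩ <;> linarith
  · rw [min_eq_right h] at *; rw [max_eq_left h] at *
    refine ⟨⟨?_, ?_⟩, ?_, ?_⟩ <;> linarith

noncomputable def auxU (R ε r : ℝ) : ℝ := -ε * Real.log ((R - r) / ε)

open Classical in
noncomputable def auxChi (R ε r : ℝ) : ℝ :=
  if r < R then Real.smoothTransition (auxU R ε r) else 1

lemma auxChi_lt {R ε r : ℝ} (h : r < R) :
    auxChi R ε r = Real.smoothTransition (auxU R ε r) := by simp [auxChi, h]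

lemma auxChi_zero {R ε r : ℝ} (hε : 0 < ε) (h : r ≤ R - ε) : auxChi R ε r = 0 := by
  rw [auxChi_lt (by linarith)]
  apply Real.smoothTransition.zero_of_nonpos
  have : 0 ≤ Real.log ((R - r) / ε) := Real.log_nonneg (by rw [le_div_iff₀ hε]; linarith)
  unfold auxU
  nlinarith

lemma auxChi_one {R ε r : ℝ} (hε : 0 < ε) (h : R - ε * Real.exp (-1 / ε) < r) :
    auxChi R ε r = 1 := by
  by_cases hr : r < R
  · rw [auxChi_lt hr]
    apply Real.smoothTransition.one_of_one_le
    have : Real.log ((R - r) / ε) ≤ -1 / ε := by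
      rw [Real.log_le_iff_le_exp (div_pos (by linarith) hε), div_le_iff₀ hε]
      linarith
    rw [le_div_iff₀ hε] at this
    unfold auxU
    linarith
  · simp [auxChi, hr]

lemma auxU_deriv {R ε r : ℝ} (hε : 0 < ε) (h : r < R) :
    HasDerivAt (auxU R ε) (ε / (R - r)) r := by
  have h1 : HasDerivAt (fun r => (R - r) / ε) (-1 / ε) r :=
    ((hasDerivAt_id r).const_sub R).div_const ε
  have hp : R - r ≠ 0 := by linarith
  have : HasDerivAt (auxU R ε) _ r := (h1.log (div_ne_zero hp hε.ne')).const_mul (-ε)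
  refine this.congr_deriv ?_
  field_simp

lemma auxChi_contDiff {R ε : ℝ} (hε : 0 < ε) : ContDiff ℝ (⊤ : ℕ∞) (auxChi R ε) := by
  rw [contDiff_iff_contDiffAt]
  intro r
  by_cases hr : r < R
  · have : auxChi R ε =ᶠ[nhds r] fun r => Real.smoothTransition (auxU R ε r) := by
      filter_upwards [Iio_mem_nhds hr] with y hy
      exact auxChi_lt hy
    refine ContDiffAt.congr_of_eventuallyEq ?_ this
    have h2 : ContDiffAt ℝ (⊤ : ℕ∞) (auxU R ε) r := by
      unfold auxU
      refine contDiffAt_const.mul (ContDiffAt.log ?_ ?_)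
      · exact (contDiffAt_const.sub contDiffAt_id).div_const _
      · exact div_ne_zero (by linarith) hε.ne'
    exact (Real.smoothTransition.contDiff (n := (⊤ : ℕ∞))).contDiffAt.comp r h2
  · have : auxChi R ε =ᶠ[nhds r] fun r => 1 := by
      have : R - ε * Real.exp (-1 / ε) < r := by
        have := mul_pos hε (Real.exp_pos (-1 / ε)); linarith
      filter_upwards [Ioi_mem_nhds this] with y hy
      exact auxChi_one hε hy
    exact ContDiffAt.congr_of_eventuallyEq contDiffAt_const this

lemma aux_second (R : ℝ) (b f : ℝ → ℝ)
    (hb : ContDiff ℝ (⊤ : ℕ∞) b) (hf : ContDiff ℝ (⊤ : ℕ∞) f) {ε r : ℝ} (hε : 0 < ε)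
    (h : r < R) :
    deriv (deriv (fun r => b r + auxChi R ε r * f r)) r =
      deriv (deriv b) r + Real.smoothTransition (auxU R ε r) * deriv (deriv f) r
      + 2 * deriv Real.smoothTransition (auxU R ε r) * ε * (deriv f r / (R - r))
      + (deriv (deriv Real.smoothTransition) (auxU R ε r) * ε ^ 2
          + deriv Real.smoothTransition (auxU R ε r) * ε) * (f r / (R - r) ^ 2) := by
  have hs : ContDiff ℝ (⊤ : ℕ∞) Real.smoothTransition := Real.smoothTransition.contDiff
  have D : ∀ {g : ℝ → ℝ}, ContDiff ℝ (⊤ : ℕ∞) g → ∀ x, HasDerivAt g (deriv g x) x :=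
    fun hg x => (hg.differentiable (by simp)).differentiableAt.hasDerivAt
  have D2 : ∀ {g : ℝ → ℝ}, ContDiff ℝ (⊤ : ℕ∞) g → ContDiff ℝ (⊤ : ℕ∞) (deriv g) :=
    fun hg => (contDiff_infty_iff_deriv.1 hg).2
  have E1 : deriv (fun r => b r + auxChi R ε r * f r) =ᶠ[nhds r] fun r =>
      deriv b r + (deriv Real.smoothTransition (auxU R ε r) * (ε / (R - r)) * f r
        + Real.smoothTransition (auxU R ε r) * deriv f r) := by
    filter_upwards [Iio_mem_nhds h] with y hy
    have hc : HasDerivAt (auxChi R ε)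
        (deriv Real.smoothTransition (auxU R ε y) * (ε / (R - y))) y := by
      refine ((D hs _).comp y (auxU_deriv hε hy)).congr_of_eventuallyEq ?_
      filter_upwards [Iio_mem_nhds hy] with z hz
      exact auxChi_lt hz
    have := ((D hb y).add (hc.mul (D hf y))).deriv
    rw [auxChi_lt hy] at this
    exact this
  rw [E1.deriv_eq]
  have hp : R - r ≠ 0 := by linarith
  have hu := auxU_deriv hε h
  have hd : HasDerivAt (fun r => ε / (R - r)) (ε / (R - r) ^ 2) r := by
    have : HasDerivAt (fun r => ε / (R - r)) _ r :=
      (hasDerivAt_const r ε).div ((hasDerivAt_id r).const_sub R) hp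
    refine this.congr_deriv ?_
    simp
  have key := ((D (D2 hb) r).add (((((D (D2 hs) _).comp r hu).mul hd).mul (D hf r)).add
    (((D hs _).comp r hu).mul (D (D2 hf) r)))).deriv
  refine key.trans ?_
  simp only [Function.comp, Pi.mul_apply]
  field_simp
  ring

/-- Lemma on smoothing the glued function: interpolation between two C^∞ functions
agreeing to first order at `R`, with control on the second derivative. -/
theorem smoothing_lemma (R : ℝ) (b c : ℝ → ℝ)
    (hb : ContDiff ℝ (⊤ : ℕ∞) b) (hc : ContDiff ℝ (⊤ : ℕ∞) c)
    (h0 : b R = c R) (h1 : deriv b R = deriv c R) :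
    ∃ (a : ℝ → ℝ → ℝ) (δ : ℝ → ℝ),
      (∀ ε > 0, 0 < δ ε) ∧
      Tendsto δ (nhdsWithin 0 (Ioi 0)) (nhds 0) ∧
      (∀ ε > 0, ContDiff ℝ (⊤ : ℕ∞) (a ε)) ∧
      (∀ ε > 0, ∀ r ≤ R - δ ε, a ε r = b r) ∧
      (∀ ε > 0, ∀ r ≥ R, a ε r = c r) ∧
      Tendsto (fun ε => sInf (iteratedDeriv 2 (a ε) '' Icc (R - δ ε) R))
        (nhdsWithin 0 (Ioi 0))
        (nhds (min (iteratedDeriv 2 b R) (iteratedDeriv 2 c R))) ∧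
      Tendsto (fun ε => sSup (iteratedDeriv 2 (a ε) '' Icc (R - δ ε) R))
        (nhdsWithin 0 (Ioi 0))
        (nhds (max (iteratedDeriv 2 b R) (iteratedDeriv 2 c R))) := by
  have D2 : ∀ {g : ℝ → ℝ}, ContDiff ℝ (⊤ : ℕ∞) g → ContDiff ℝ (⊤ : ℕ∞) (deriv g) :=
    fun hg => (contDiff_infty_iff_deriv.1 hg).2
  have Df : ∀ {g : ℝ → ℝ}, ContDiff ℝ (⊤ : ℕ∞) g → Differentiable ℝ g :=
    fun hg => hg.differentiable (by simp)
  have hf : ContDiff ℝ (⊤ : ℕ∞) (fun r => c r - b r) := hc.sub hb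
  have hf1 : deriv (fun r => c r - b r) = fun r => deriv c r - deriv b r := by
    funext r
    exact deriv_fun_sub (Df hc r) (Df hb r)
  have hf2 : deriv (deriv (fun r => c r - b r)) =
      fun r => deriv (deriv c) r - deriv (deriv b) r := by
    rw [hf1]; funext r
    exact deriv_fun_sub (Df (D2 hc) r) (Df (D2 hb) r)
  obtain ⟨M, hM0, hM1, hM2⟩ := aux_bdd
  obtain ⟨K, hK0, hK⟩ := aux_taylor R _ hf (by simp [h0]) (by rw [hf1]; simp [h1])
  have i2 : ∀ g : ℝ → ℝ, iteratedDeriv 2 g = deriv (deriv g) := fun g => by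
    rw [iteratedDeriv_succ, iteratedDeriv_one]
  have expos : ∀ ε > 0, 0 < ε * Real.exp (-1 / ε) := fun ε hε => mul_pos hε (Real.exp_pos _)
  set a : ℝ → ℝ → ℝ := fun ε r => b r + auxChi R ε r * (c r - b r) with ha
  have aL : ∀ ε > 0, ∀ r ≤ R - ε, a ε r = b r := by
    intro ε hε r hr
    simp [ha, auxChi_zero hε hr]
  have aR : ∀ ε > 0, ∀ r > R - ε * Real.exp (-1 / ε), a ε r = c r := by
    intro ε hε r hr
    simp [ha, auxChi_one hε hr]
  have main : ∀ e > 0, ∀ᶠ ε in nhdsWithin (0:ℝ) (Ioi 0),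
      |sInf (iteratedDeriv 2 (a ε) '' Icc (R - 2 * ε) R) -
        min (iteratedDeriv 2 b R) (iteratedDeriv 2 c R)| ≤ e ∧
      |sSup (iteratedDeriv 2 (a ε) '' Icc (R - 2 * ε) R) -
        max (iteratedDeriv 2 b R) (iteratedDeriv 2 c R)| ≤ e := by
    intro e he
    simp only [i2]
    obtain ⟨d1, hd1, H1⟩ := Metric.continuous_iff.1 (D2 (D2 hb)).continuous R (e/2) (by linarith)
    obtain ⟨d2, hd2, H2⟩ := Metric.continuous_iff.1 (D2 (D2 hc)).continuous R (e/2) (by linarith)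
    have hlim : Tendsto (fun ε : ℝ => 2 * M * ε * K + (M * ε ^ 2 + M * ε) * K)
        (nhdsWithin 0 (Ioi 0)) (nhds 0) := by
      have : Continuous (fun ε : ℝ => 2 * M * ε * K + (M * ε ^ 2 + M * ε) * K) := by fun_prop
      have := this.tendsto 0
      simp only [mul_zero, zero_mul, add_zero, ne_eq, OfNat.ofNat_ne_zero, not_false_eq_true,
        zero_pow] at this
      exact this.mono_left nhdsWithin_le_nhds
    have hsm : ∀ᶠ ε in nhdsWithin (0:ℝ) (Ioi 0), ε < min (1/2) (min (d1/2) (d2/2)) :=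
      nhdsWithin_le_nhds (Iio_mem_nhds (by positivity))
    filter_upwards [self_mem_nhdsWithin, hsm, hlim.eventually_lt_const (half_pos he)]
      with ε hε hs herr
    replace hε : 0 < ε := hε
    simp only [lt_min_iff] at hs
    obtain ⟨hs0, hs1, hs2⟩ := hs
    have B1 : ∀ r ∈ Icc (R - 2 * ε) R, |deriv (deriv b) r - deriv (deriv b) R| < e/2 := by
      intro r hr
      refine H1 r ?_
      rw [Real.dist_eq, abs_lt]; constructor <;> linarith [hr.1, hr.2]
    have C1 : ∀ r ∈ Icc (R - 2 * ε) R, |deriv (deriv c) r - deriv (deriv c) R| < e/2 := by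
      intro r hr
      refine H2 r ?_
      rw [Real.dist_eq, abs_lt]; constructor <;> linarith [hr.1, hr.2]
    have vL : deriv (deriv (a ε)) (R - 2 * ε) = deriv (deriv b) (R - 2 * ε) := by
      have : a ε =ᶠ[nhds (R - 2 * ε)] b := by
        filter_upwards [Iio_mem_nhds (show R - 2 * ε < R - ε by linarith)] with y hy
        exact aL ε hε y (le_of_lt hy)
      exact this.deriv.deriv_eq
    have vR : deriv (deriv (a ε)) R = deriv (deriv c) R := by
      have : a ε =ᶠ[nhds R] c := by
        filter_upwards [Ioi_mem_nhds (show R - ε * Real.exp (-1 / ε) < R by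
          linarith [expos ε hε])] with y hy
        exact aR ε hε y hy
      exact this.deriv.deriv_eq
    have mL : R - 2 * ε ∈ Icc (R - 2 * ε) R := ⟨le_rfl, by linarith⟩
    have mR : R ∈ Icc (R - 2 * ε) R := ⟨by linarith, le_rfl⟩
    refine aux_ext _ _ _ e ?_ _ _ ⟨_, mL, vL⟩ ⟨_, mR, vR⟩ ?_ ?_
    · rintro _ ⟨r, hr, rfl⟩
      beta_reduce
      rcases eq_or_lt_of_le hr.2 with h | h
      · rw [h, vR]
        constructor
        · linarith [min_le_right (deriv (deriv b) R) (deriv (deriv c) R)]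
        · linarith [le_max_right (deriv (deriv b) R) (deriv (deriv c) R)]
      · have hform := aux_second R b _ hb hf hε h
        obtain ⟨k1, k2⟩ := hK r ⟨by linarith [hr.1], hr.2⟩
        have hp : 0 < R - r := by linarith
        have q1 : |deriv (fun r => c r - b r) r / (R - r)| ≤ K := by
          rw [abs_div, abs_of_pos hp, div_le_iff₀ hp]; exact k1
        have q2 : |(c r - b r) / (R - r) ^ 2| ≤ K := by
          rw [abs_div, abs_of_pos (pow_pos hp 2), div_le_iff₀ (pow_pos hp 2)]; exact k2
        rw [hf2] at hform
        have hval : deriv (deriv (a ε)) r = _ := hform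
        rw [hval]
        beta_reduce
        generalize deriv (fun r => c r - b r) r / (R - r) = X at *
        generalize (c r - b r) / (R - r) ^ 2 = Y at *
        have m1 := hM1 (auxU R ε r)
        have m2 := hM2 (auxU R ε r)
        generalize deriv (deriv Real.smoothTransition) (auxU R ε r) = P2 at *
        generalize deriv Real.smoothTransition (auxU R ε r) = P1 at *
        have t0 := Real.smoothTransition.nonneg (auxU R ε r)
        have t1 := Real.smoothTransition.le_one (auxU R ε r)
        generalize Real.smoothTransition (auxU R ε r) = t at *
        have e1 : |2 * P1 * ε * X| ≤ 2 * M * ε * K := by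
          rw [abs_mul, abs_mul, abs_mul, abs_of_pos hε, abs_of_pos (two_pos)]
          gcongr
        have e2 : |(P2 * ε ^ 2 + P1 * ε) * Y| ≤ (M * ε ^ 2 + M * ε) * K := by
          rw [abs_mul]
          gcongr
          refine (abs_add_le _ _).trans ?_
          rw [abs_mul, abs_mul, abs_of_pos hε, abs_of_pos (pow_pos hε 2)]
          gcongr
        have b1 := abs_lt.1 (B1 r hr)
        have c1 := abs_lt.1 (C1 r hr)
        rw [abs_le] at e1 e2
        have n1 := min_le_left (deriv (deriv b) R) (deriv (deriv c) R)
        have n2 := min_le_right (deriv (deriv b) R) (deriv (deriv c) R)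
        have n3 := le_max_left (deriv (deriv b) R) (deriv (deriv c) R)
        have n4 := le_max_right (deriv (deriv b) R) (deriv (deriv c) R)
        generalize min (deriv (deriv b) R) (deriv (deriv c) R) = m at *
        generalize max (deriv (deriv b) R) (deriv (deriv c) R) = m' at *
        have u1 : 0 ≤ (1 - t) * (deriv (deriv b) r - (m - e/2)) :=
          mul_nonneg (by linarith) (by linarith)
        have u2 : 0 ≤ t * (deriv (deriv c) r - (m - e/2)) :=
          mul_nonneg (by linarith) (by linarith)
        have u3 : 0 ≤ (1 - t) * ((m' + e/2) - deriv (deriv b) r) :=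
          mul_nonneg (by linarith) (by linarith)
        have u4 : 0 ≤ t * ((m' + e/2) - deriv (deriv c) r) :=
          mul_nonneg (by linarith) (by linarith)
        constructor <;> linarith
    · linarith [B1 _ mL]
    · simpa using he.le
  refine ⟨a, fun ε => 2 * ε, fun ε hε => by linarith, ?_, ?_, ?_, ?_, ?_, ?_⟩
  · have : Tendsto (fun ε : ℝ => 2 * ε) (nhds 0) (nhds (2 * 0)) :=
      (continuous_const.mul continuous_id).tendsto 0
    rw [mul_zero] at this
    exact this.mono_left nhdsWithin_le_nhds
  · intro ε hε
    exact hb.add ((auxChi_contDiff hε).mul hf)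
  · intro ε hε r hr
    exact aL ε hε r (by linarith)
  · intro ε hε r hr
    exact aR ε hε r (by linarith [expos ε hε])
  · rw [Metric.tendsto_nhds]
    intro e he
    filter_upwards [main (e/2) (by linarith)] with ε h
    rw [Real.dist_eq]; linarith [h.1]
  · rw [Metric.tendsto_nhds]
    intro e he
    filter_upwards [main (e/2) (by linarith)] with ε h
    rw [Real.dist_eq]; linarith [h.2]
end

section
/- For every real R > 0 there exist C^∞ functions f, g : ℝ → ℝ and a real number R₁ < R such that: f(r) = sinh(r) and g(r) = cosh(r) for all r ∈ [R₁, R]; and f(r) > 0, f′(r) > 0, f″(r) > 0, g(r) > 0, g′(r) > 0, g″(r) > 0 for all r ≤ R. -/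
open Set

open Polynomial in
theorem aux_e (t : ℝ) : HasDerivAt expNegInvGlue (t⁻¹ ^ 2 * expNegInvGlue t) t := by
  have h := expNegInvGlue.hasDerivAt_polynomial_eval_inv_mul (1 : ℝ[X]) t
  simpa using h

open Polynomial in
theorem aux_e2 (t : ℝ) : HasDerivAt (fun t => (1 + t⁻¹) * expNegInvGlue t)
    (t⁻¹ ^ 3 * expNegInvGlue t) t := by
  have h := expNegInvGlue.hasDerivAt_polynomial_eval_inv_mul (1 + X : ℝ[X]) t
  simp only [eval_add, eval_one, eval_X, eval_mul, eval_pow, derivative_add, derivative_one,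
    derivative_X, eval_sub, eval_zero] at h
  convert h using 1
  ring

/-- The model function. -/
noncomputable def mfun (t : ℝ) : ℝ := 1 - t + t * expNegInvGlue t

theorem mfun_deriv (t : ℝ) : HasDerivAt mfun (-1 + (1 + t⁻¹) * expNegInvGlue t) t := by
  have h := ((hasDerivAt_const t (1 : ℝ)).sub (hasDerivAt_id t)).add
    ((hasDerivAt_id t).mul (aux_e t))
  refine HasDerivAt.congr_deriv h ?_
  rcases eq_or_ne t 0 with rfl | ht
  · simp
  · simp; field_simp

theorem mfun_pos (t : ℝ) : 0 < mfun t := by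
  unfold mfun
  rcases le_or_gt t 0 with h | h
  · rw [expNegInvGlue.zero_of_nonpos h]; linarith
  · have h1 : expNegInvGlue t = Real.exp (-t⁻¹) := by simp [expNegInvGlue, not_le.2 h]
    have h2 : -t⁻¹ + 1 < Real.exp (-t⁻¹) := Real.add_one_lt_exp (by simp [h.ne'])
    rw [h1]
    have h3 := mul_lt_mul_of_pos_left h2 h
    have h4 : t * t⁻¹ = 1 := mul_inv_cancel₀ h.ne'
    nlinarith

theorem mfun_deriv_neg (t : ℝ) : -1 + (1 + t⁻¹) * expNegInvGlue t < 0 := by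
  rcases le_or_gt t 0 with h | h
  · rw [expNegInvGlue.zero_of_nonpos h]; linarith
  · have h1 : expNegInvGlue t = Real.exp (-t⁻¹) := by simp [expNegInvGlue, not_le.2 h]
    have h2 : t⁻¹ + 1 < Real.exp (t⁻¹) := Real.add_one_lt_exp (by simp [h.ne'])
    rw [h1]
    have h3 := mul_lt_mul_of_pos_right h2 (Real.exp_pos (-t⁻¹))
    rw [← Real.exp_add] at h3
    simp at h3
    linarith

theorem mfun_deriv2_nonneg (t : ℝ) : 0 ≤ t⁻¹ ^ 3 * expNegInvGlue t := by
  rcases le_or_gt t 0 with h | h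
  · rw [expNegInvGlue.zero_of_nonpos h]; simp
  · have := expNegInvGlue.nonneg t
    positivity

theorem aux_k (c : ℝ) (hc : 0 < c) : ∃ k k1 k2 : ℝ → ℝ, ContDiff ℝ (⊤ : ℕ∞) k ∧
    (∀ r, HasDerivAt k (k1 r) r) ∧ (∀ r, HasDerivAt k1 (k2 r) r) ∧
    (∀ r, 0 < k r) ∧ (∀ r, 0 < k1 r) ∧ (∀ r, 0 ≤ k2 r) ∧ ∀ r, c ≤ r → k r = r := by
  have hl : ∀ r : ℝ, HasDerivAt (fun r : ℝ => 1 - r / c) (-(1 / c)) r := fun r => by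
    simpa using ((hasDerivAt_id r).div_const c).const_sub 1
  refine ⟨fun r => c * mfun (1 - r / c),
    fun r => -(-1 + (1 + (1 - r / c)⁻¹) * expNegInvGlue (1 - r / c)),
    fun r => (1 / c) * ((1 - r / c)⁻¹ ^ 3 * expNegInvGlue (1 - r / c)),
    ?_, ?_, ?_, ?_, ?_, ?_, ?_⟩
  · have he : ContDiff ℝ (⊤ : ℕ∞) expNegInvGlue := expNegInvGlue.contDiff
    unfold mfun
    fun_prop
  · intro r
    have h := ((mfun_deriv (1 - r / c)).comp r (hl r)).const_mul c
    refine HasDerivAt.congr_deriv h ?_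
    field_simp
  · intro r
    have h := (((aux_e2 (1 - r / c)).comp r (hl r)).const_add (-1)).neg
    refine HasDerivAt.congr_deriv h ?_
    ring
  · intro r; exact mul_pos hc (mfun_pos _)
  · intro r; have := mfun_deriv_neg (1 - r / c); simp only; linarith
  · intro r; exact mul_nonneg (by positivity) (mfun_deriv2_nonneg _)
  · intro r hr
    have : 1 - r / c ≤ 0 := by
      have := (one_le_div hc).2 hr
      linarith
    simp only [mfun, expNegInvGlue.zero_of_nonpos this]
    field_simp
    ring

/-- Kerckhoff's construction: smooth functions `f`, `g` equal to `sinh`, `cosh` near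
`R` with `f, f′, f″, g, g′, g″ > 0` on `(-∞, R]`, yielding a negatively curved
metric on the drilled manifold. -/
theorem negatively_curved_filling (R : ℝ) (hR : 0 < R) :
    ∃ (f g : ℝ → ℝ) (R₁ : ℝ), R₁ < R ∧
      ContDiff ℝ (⊤ : ℕ∞) f ∧ ContDiff ℝ (⊤ : ℕ∞) g ∧
      (∀ r ∈ Icc R₁ R, f r = Real.sinh r ∧ g r = Real.cosh r) ∧
      (∀ r ≤ R, 0 < f r ∧ 0 < deriv f r ∧ 0 < iteratedDeriv 2 f r ∧
        0 < g r ∧ 0 < deriv g r ∧ 0 < iteratedDeriv 2 g r) := by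
  obtain ⟨k, k1, k2, hk, h1, h2, p0, p1, p2, hr⟩ := aux_k (R / 2) (by positivity)
  have df : deriv (fun r => Real.sinh (k r)) = fun r => Real.cosh (k r) * k1 r :=
    funext fun r => (h1 r).sinh.deriv
  have dg : deriv (fun r => Real.cosh (k r)) = fun r => Real.sinh (k r) * k1 r :=
    funext fun r => (h1 r).cosh.deriv
  refine ⟨fun r => Real.sinh (k r), fun r => Real.cosh (k r), R / 2, by linarith,
    Real.contDiff_sinh.comp hk, Real.contDiff_cosh.comp hk, ?_, ?_⟩
  · intro r h
    simp [hr r h.1]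
  · intro r _
    have s := Real.sinh_pos_iff.2 (p0 r)
    have c := Real.cosh_pos (k r)
    have q1 := p1 r
    have q2 := p2 r
    have e1 : deriv (fun r => Real.cosh (k r) * k1 r) r =
        Real.sinh (k r) * k1 r * k1 r + Real.cosh (k r) * k2 r :=
      ((h1 r).cosh.mul (h2 r)).deriv
    have e2 : deriv (fun r => Real.sinh (k r) * k1 r) r =
        Real.cosh (k r) * k1 r * k1 r + Real.sinh (k r) * k2 r :=
      ((h1 r).sinh.mul (h2 r)).deriv
    simp only [iteratedDeriv_succ, iteratedDeriv_zero, df, dg, e1, e2]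
    refine ⟨s, by positivity, by positivity, c, by positivity, by positivity⟩
end

section
/- Let R > 0 and let b(r) = sinh(R)·exp(coth(R)·(r − R)). Then for every ε > 0 there exist a C^∞ function f_ε : ℝ → ℝ and δ(ε) > 0 with δ(ε) → 0 as ε → 0⁺, such that f_ε(r) = b(r) for r ≤ R − δ(ε), f_ε(r) = sinh(r) for r ≥ R, f_ε(r) > 0, f_ε′(r) > 0 and f_ε″(r) > 0 for all r (for all sufficiently small ε), and sup_{r ∈ ℝ} f_ε″(r)/f_ε(r) → coth²(R) as ε → 0⁺. -/
open Filter Set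

noncomputable def coth (x : ℝ) : ℝ := Real.cosh x / Real.sinh x

lemma rs_it2 {f F F1 : ℝ → ℝ} {r v : ℝ} (h : f =ᶠ[nhds r] F)
    (h1 : ∀ᶠ x in nhds r, HasDerivAt F (F1 x) x) (h2 : HasDerivAt F1 v r) :
    deriv f r = F1 r ∧ iteratedDeriv 2 f r = v := by
  have e1 : deriv F =ᶠ[nhds r] F1 := h1.mono fun x hx => hx.deriv
  refine ⟨h.deriv_eq.trans e1.eq_of_nhds, ?_⟩
  have : iteratedDeriv 2 f = deriv (deriv f) := by
    rw [iteratedDeriv_succ, iteratedDeriv_one]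
  rw [this, (h.deriv.trans e1).deriv_eq, h2.deriv]

lemma rs_S_bound : ∃ M : ℝ, 0 ≤ M ∧ ∀ x ∈ Icc (0 : ℝ) 1,
    |deriv Real.smoothTransition x| ≤ M ∧ |deriv (deriv Real.smoothTransition) x| ≤ M := by
  have h0 : ContDiff ℝ 2 Real.smoothTransition := Real.smoothTransition.contDiff
  have h1 : ContDiff ℝ 1 (deriv Real.smoothTransition) := by
    apply ContDiff.deriv' (n := 1); exact h0
  have h2 : Continuous (deriv (deriv Real.smoothTransition)) := h1.continuous_deriv le_rfl
  obtain ⟨A, hA⟩ := isCompact_Icc.exists_bound_of_continuousOn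
    (s := Icc (0 : ℝ) 1) h1.continuous.continuousOn
  obtain ⟨B, hB⟩ := isCompact_Icc.exists_bound_of_continuousOn
    (s := Icc (0 : ℝ) 1) h2.continuousOn
  refine ⟨max 0 (max A B), le_max_left _ _, fun x hx => ⟨?_, ?_⟩⟩
  · exact (hA x hx).trans ((le_max_left _ _).trans (le_max_right _ _))
  · exact (hB x hx).trans ((le_max_right _ _).trans (le_max_right _ _))

lemma rs_S_deriv (x : ℝ) :
    HasDerivAt Real.smoothTransition (deriv Real.smoothTransition x) x ∧
    HasDerivAt (deriv Real.smoothTransition) (deriv (deriv Real.smoothTransition) x) x := by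
  have h0 : ContDiff ℝ 2 Real.smoothTransition := Real.smoothTransition.contDiff
  have h1 : ContDiff ℝ 1 (deriv Real.smoothTransition) := by
    apply ContDiff.deriv' (n := 1); exact h0
  exact ⟨(h0.differentiable (by norm_num) x).hasDerivAt,
    (h1.differentiable (by norm_num) x).hasDerivAt⟩

lemma rs_g_bound (R : ℝ) (g g1 g2 : ℝ → ℝ) (hg : ∀ x, HasDerivAt g (g1 x) x)
    (hg1 : ∀ x, HasDerivAt g1 (g2 x) x) (hc : Continuous g2) (h0 : g R = 0) (h1 : g1 R = 0) :
    ∃ C : ℝ, 0 ≤ C ∧ ∀ r ∈ Icc (R - 1) R,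
      |g1 r| ≤ C * (R - r) ∧ |g r| ≤ C * (R - r) ^ 2 := by
  obtain ⟨C, hC⟩ := isCompact_Icc.exists_bound_of_continuousOn
    (s := Icc (R - 1) R) hc.continuousOn
  have hC0 : 0 ≤ C := (norm_nonneg _).trans (hC R ⟨by linarith, le_rfl⟩)
  have A : ∀ r ∈ Icc (R - 1) R, |g1 r| ≤ C * (R - r) := by
    intro r hr
    have := (convex_Icc (R - 1) R).norm_image_sub_le_of_norm_hasDerivWithin_le
      (f := g1) (f' := g2) (fun x _ => (hg1 x).hasDerivWithinAt) hC
      (⟨by linarith, le_rfl⟩ : R ∈ Icc (R - 1) R) hr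
    rw [h1, sub_zero, Real.norm_eq_abs, Real.norm_eq_abs, abs_sub_comm,
      abs_of_nonneg (by linarith [hr.2] : 0 ≤ R - r)] at this
    exact this
  refine ⟨C, hC0, fun r hr => ⟨A r hr, ?_⟩⟩
  have := (convex_Icc r R).norm_image_sub_le_of_norm_hasDerivWithin_le
      (f := g) (f' := g1) (C := C * (R - r)) (fun x _ => (hg x).hasDerivWithinAt)
      (fun x hx => by
        refine (A x ⟨hr.1.trans hx.1, hx.2⟩).trans ?_
        exact mul_le_mul_of_nonneg_left (by linarith [hx.1]) hC0)
      (⟨hr.2, le_rfl⟩ : R ∈ Icc r R) ⟨le_rfl, hr.2⟩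
  rw [h0, sub_zero, Real.norm_eq_abs, Real.norm_eq_abs, abs_sub_comm,
      abs_of_nonneg (by linarith [hr.2] : 0 ≤ R - r)] at this
  linarith [this, (by ring : C * (R - r) * (R - r) = C * (R - r) ^ 2)]

/-- logarithmic variable -/
noncomputable def rsT (R ε r : ℝ) : ℝ := -ε * Real.log (R - r) - 1

/-- the cutoff and its derivatives -/
noncomputable def rsP (R ε r : ℝ) : ℝ := Real.smoothTransition (rsT R ε r)
noncomputable def rsP1 (R ε r : ℝ) : ℝ :=
  deriv Real.smoothTransition (rsT R ε r) * (ε / (R - r))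
noncomputable def rsP2 (R ε r : ℝ) : ℝ :=
  deriv (deriv Real.smoothTransition) (rsT R ε r) * (ε / (R - r)) * (ε / (R - r)) +
  deriv Real.smoothTransition (rsT R ε r) * (ε / (R - r) ^ 2)

lemma rsT_deriv {R ε r : ℝ} (h : r < R) : HasDerivAt (rsT R ε) (ε / (R - r)) r := by
  have h0 : R - r ≠ 0 := by linarith
  have := ((((hasDerivAt_id r).const_sub R).log h0).const_mul (-ε)).sub_const 1
  refine HasDerivAt.congr_deriv (f := rsT R ε) this ?_
  simp only [id]
  field_simp

lemma rsP_deriv {R ε r : ℝ} (h : r < R) : HasDerivAt (rsP R ε) (rsP1 R ε r) r :=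
  (rs_S_deriv _).1.comp r (rsT_deriv h)

lemma rsP1_deriv {R ε r : ℝ} (h : r < R) : HasDerivAt (rsP1 R ε) (rsP2 R ε r) r := by
  have h0 : R - r ≠ 0 := by linarith
  have h1 : HasDerivAt (fun x => ε / (R - x)) (ε / (R - r) ^ 2) r := by
    have := ((hasDerivAt_const r ε).div ((hasDerivAt_id r).const_sub R) h0)
    refine HasDerivAt.congr_deriv (f := fun x => ε / (R - x)) this ?_
    simp
  exact ((rs_S_deriv (rsT R ε r)).2.comp r (rsT_deriv h)).mul h1

lemma rsP_contDiffAt {R ε r : ℝ} (h : r < R) : ContDiffAt ℝ (⊤ : ℕ∞) (rsP R ε) r := by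
  have h0 : R - r ≠ 0 := by linarith
  have : ContDiffAt ℝ (⊤ : ℕ∞) (rsT R ε) r := by
    unfold rsT
    exact (contDiffAt_const.mul ((contDiffAt_const.sub contDiffAt_id).log h0)).sub contDiffAt_const
  exact Real.smoothTransition.contDiff.contDiffAt.comp r this

lemma rsT_nonpos {R ε r : ℝ} (hε : 0 < ε) (h : r ≤ R - Real.exp (-1 / ε)) : rsT R ε r ≤ 0 := by
  have h1 : -1 / ε ≤ Real.log (R - r) := by
    rw [Real.le_log_iff_exp_le (by linarith [Real.exp_pos (-1 / ε)])]; linarith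
  rw [div_le_iff₀ hε] at h1
  unfold rsT; linarith

lemma rsT_nonneg {R ε r : ℝ} (hε : 0 < ε) (hr : r < R) (h : R - Real.exp (-1 / ε) ≤ r) :
    0 ≤ rsT R ε r := by
  have h1 : Real.log (R - r) ≤ -1 / ε := by
    rw [Real.log_le_iff_le_exp (by linarith)]; linarith
  rw [le_div_iff₀ hε] at h1
  unfold rsT; linarith

lemma rsT_ge_one {R ε r : ℝ} (hε : 0 < ε) (hr : r < R) (h : R - Real.exp (-2 / ε) ≤ r) :
    1 ≤ rsT R ε r := by
  have h1 : Real.log (R - r) ≤ -2 / ε := by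
    rw [Real.log_le_iff_le_exp (by linarith)]; linarith
  rw [le_div_iff₀ hε] at h1
  unfold rsT; linarith

lemma rsT_le_one {R ε r : ℝ} (hε : 0 < ε) (h : r ≤ R - Real.exp (-2 / ε)) : rsT R ε r ≤ 1 := by
  have h1 : -2 / ε ≤ Real.log (R - r) := by
    rw [Real.le_log_iff_exp_le (by linarith [Real.exp_pos (-2 / ε)])]; linarith
  rw [div_le_iff₀ hε] at h1
  unfold rsT; linarith

/-- the glued function -/
noncomputable def rsF (R : ℝ) (b : ℝ → ℝ) (ε r : ℝ) : ℝ :=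
  if r < R then b r + rsP R ε r * (Real.sinh r - b r) else Real.sinh r

lemma rsF_left {R : ℝ} {b : ℝ → ℝ} {ε r : ℝ} (hε : 0 < ε) (h : r ≤ R - Real.exp (-1 / ε)) :
    rsF R b ε r = b r := by
  have : r < R := by linarith [Real.exp_pos (-1 / ε)]
  simp [rsF, this, rsP, Real.smoothTransition.zero_of_nonpos (rsT_nonpos hε h)]

lemma rsF_right {R : ℝ} {b : ℝ → ℝ} {ε r : ℝ} (hε : 0 < ε) (h : R - Real.exp (-2 / ε) ≤ r) :
    rsF R b ε r = Real.sinh r := by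
  by_cases hr : r < R
  · simp [rsF, hr, rsP, Real.smoothTransition.one_of_one_le (rsT_ge_one hε hr h)]
  · simp [rsF, hr]

lemma rsF_contDiff {R : ℝ} {b : ℝ → ℝ} {ε : ℝ} (hε : 0 < ε) (hb : ContDiff ℝ (⊤ : ℕ∞) b) :
    ContDiff ℝ (⊤ : ℕ∞) (rsF R b ε) := by
  rw [contDiff_iff_contDiffAt]
  intro r
  by_cases hr : r < R
  · have e : rsF R b ε =ᶠ[nhds r] fun r => b r + rsP R ε r * (Real.sinh r - b r) := by
      filter_upwards [Iio_mem_nhds hr] with x hx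
      simp [rsF, mem_Iio.1 hx]
    refine ContDiffAt.congr_of_eventuallyEq ?_ e
    exact hb.contDiffAt.add ((rsP_contDiffAt hr).mul
      (Real.contDiff_sinh.contDiffAt.sub hb.contDiffAt))
  · have e : rsF R b ε =ᶠ[nhds r] Real.sinh := by
      have : R - Real.exp (-2 / ε) < r := by linarith [Real.exp_pos (-2 / ε)]
      filter_upwards [Ioi_mem_nhds this] with x hx
      exact rsF_right hε (le_of_lt hx)
    exact Real.contDiff_sinh.contDiffAt.congr_of_eventuallyEq e

lemma rs_delta_tendsto :
    Tendsto (fun ε : ℝ => Real.exp (-1 / ε)) (nhdsWithin 0 (Ioi 0)) (nhds 0) := by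
  have h : Tendsto (fun ε : ℝ => -(ε⁻¹)) (nhdsWithin 0 (Ioi 0)) atBot :=
    tendsto_neg_atTop_atBot.comp tendsto_inv_nhdsGT_zero
  refine (Real.tendsto_exp_atBot.comp h).congr fun x => ?_
  simp [neg_div]

/-- the core pointwise estimate in the transition region -/
lemma rs_mid {M C ε x S1 S2 g g1 : ℝ} (hx : 0 < x) (hx1 : x ≤ 1) (hε : 0 < ε) (hε1 : ε ≤ 1)
    (hM : 0 ≤ M) (hC : 0 ≤ C) (h1 : |S1| ≤ M) (h2 : |S2| ≤ M) (hg1 : |g1| ≤ C * x)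
    (hg : |g| ≤ C * x ^ 2) :
    |S1 * (ε / x) * g| ≤ 4 * M * C * ε ∧
    |(S2 * (ε / x) * (ε / x) + S1 * (ε / x ^ 2)) * g + 2 * (S1 * (ε / x) * g1)|
      ≤ 4 * M * C * ε := by
  have hg' : |g / x ^ 2| ≤ C := by
    rw [abs_div, abs_of_pos (by positivity : 0 < x ^ 2), div_le_iff₀ (by positivity)]; exact hg
  have hg1' : |g1 / x| ≤ C := by
    rw [abs_div, abs_of_pos hx, div_le_iff₀ hx]; exact hg1
  have a : |S1 * (g / x ^ 2)| ≤ M * C := by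
    rw [abs_mul]; exact mul_le_mul h1 hg' (abs_nonneg _) hM
  have a2 : |S2 * (g / x ^ 2)| ≤ M * C := by
    rw [abs_mul]; exact mul_le_mul h2 hg' (abs_nonneg _) hM
  have a3 : |S1 * (g1 / x)| ≤ M * C := by
    rw [abs_mul]; exact mul_le_mul h1 hg1' (abs_nonneg _) hM
  have hMC : 0 ≤ M * C := mul_nonneg hM hC
  constructor
  · have : S1 * (ε / x) * g = (ε * x) * (S1 * (g / x ^ 2)) := by field_simp
    rw [this, abs_mul, abs_of_pos (by positivity : 0 < ε * x)]
    have : ε * x ≤ ε := by nlinarith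
    calc ε * x * |S1 * (g / x ^ 2)| ≤ ε * (M * C) := mul_le_mul this a (abs_nonneg _) hε.le
      _ ≤ _ := by nlinarith
  · have : (S2 * (ε / x) * (ε / x) + S1 * (ε / x ^ 2)) * g + 2 * (S1 * (ε / x) * g1)
      = ε * (ε * (S2 * (g / x ^ 2)) + (S1 * (g / x ^ 2)) + 2 * (S1 * (g1 / x))) := by
      field_simp
    rw [this, abs_mul, abs_of_pos hε]
    have k : |ε * (S2 * (g / x ^ 2))| ≤ M * C := by
      rw [abs_mul, abs_of_pos hε]; nlinarith [abs_nonneg (S2 * (g / x ^ 2))]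
    have : |ε * (S2 * (g / x ^ 2)) + (S1 * (g / x ^ 2)) + 2 * (S1 * (g1 / x))| ≤ 4 * (M * C) := by
      rw [abs_le] at *
      constructor <;> linarith [k.1, k.2, a.1, a.2, a3.1, a3.2]
    nlinarith

lemma rs_convex {p u v m : ℝ} (h0 : 0 ≤ p) (h1 : p ≤ 1) (hu : m ≤ u) (hv : m ≤ v) :
    m ≤ u + p * (v - u) := by
  nlinarith [mul_nonneg h0 (sub_nonneg.2 hv), mul_nonneg (sub_nonneg.2 h1) (sub_nonneg.2 hu)]

/-- all pointwise information about the glued function -/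
lemma rs_key (R : ℝ) (hR : 0 < R) (b : ℝ → ℝ)
    (hb : ∀ r, b r = Real.sinh R * Real.exp (coth R * (r - R))) :
    ∃ K : ℝ, 0 ≤ K ∧ ∀ᶠ ε in nhdsWithin (0 : ℝ) (Ioi 0), ∀ r : ℝ,
      0 < rsF R b ε r ∧ 0 < deriv (rsF R b ε) r ∧ 0 < iteratedDeriv 2 (rsF R b ε) r ∧
      iteratedDeriv 2 (rsF R b ε) r / rsF R b ε r ≤ coth R ^ 2 + K * ε ∧
      (r < R - Real.exp (-1 / ε) →
        iteratedDeriv 2 (rsF R b ε) r / rsF R b ε r = coth R ^ 2) := by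
  have hs : 0 < Real.sinh R := Real.sinh_pos_iff.2 hR
  set c := coth R with hc
  have hc1 : 1 ≤ c := by
    rw [hc, coth, le_div_iff₀ hs, one_mul]; exact (Real.sinh_lt_cosh R).le
  have hc2 : 1 ≤ c ^ 2 := by nlinarith
  have hcs : c * Real.sinh R = Real.cosh R := by
    rw [hc, coth]; field_simp
  have hbpos : ∀ r, 0 < b r := fun r => by rw [hb]; positivity
  have hbd : ∀ r, HasDerivAt b (c * b r) r := by
    intro r
    have : HasDerivAt (fun r => Real.sinh R * Real.exp (c * (r - R)))
        (Real.sinh R * (Real.exp (c * (r - R)) * (c * 1))) r :=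
      ((((hasDerivAt_id r).sub_const R).const_mul c).exp).const_mul _
    rw [show b = fun r => Real.sinh R * Real.exp (c * (r - R)) from funext hb]
    refine this.congr_deriv ?_
    beta_reduce
    ring
  have hbd2 : ∀ r, HasDerivAt (fun r => c * b r) (c ^ 2 * b r) r := by
    intro r
    exact ((hbd r).const_mul c).congr_deriv (by ring)
  have hbc : Continuous b := continuous_iff_continuousAt.2 fun r => (hbd r).continuousAt
  have hbR : b R = Real.sinh R := by rw [hb]; simp
  obtain ⟨C, hC, hg⟩ := rs_g_bound R (fun r => Real.sinh r - b r)
    (fun r => Real.cosh r - c * b r) (fun r => Real.sinh r - c ^ 2 * b r)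
    (fun x => (Real.hasDerivAt_sinh x).sub (hbd x))
    (fun x => (Real.hasDerivAt_cosh x).sub (hbd2 x))
    (Real.continuous_sinh.sub (continuous_const.mul hbc)) (by simp [hbR])
    (by simp [hbR, hcs])
  obtain ⟨M, hM, hS⟩ := rs_S_bound
  obtain ⟨m, hm, hmb, hms⟩ : ∃ m : ℝ, 0 < m ∧ (∀ r, R / 2 ≤ r → m ≤ b r) ∧
      (∀ r, R / 2 ≤ r → m ≤ Real.sinh r) := by
    refine ⟨min (b (R / 2)) (Real.sinh (R / 2)), lt_min (hbpos _)
      (Real.sinh_pos_iff.2 (by linarith)), fun r hr => ?_, fun r hr => ?_⟩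
    · refine (min_le_left _ _).trans ?_
      rw [hb, hb]
      gcongr
    · exact (min_le_right _ _).trans (Real.sinh_le_sinh.2 hr)
  have hK : 0 ≤ 4 * M * C := by positivity
  refine ⟨4 * M * C / m, by positivity, ?_⟩
  have e1 : ∀ᶠ ε in nhdsWithin (0 : ℝ) (Ioi 0), Real.exp (-1 / ε) < min 1 (R / 2) :=
    rs_delta_tendsto.eventually_lt_const (lt_min one_pos (by linarith))
  have e2 : ∀ᶠ ε in nhdsWithin (0 : ℝ) (Ioi 0), ε < min 1 (m / (4 * M * C + 1)) :=
    (tendsto_id.mono_left nhdsWithin_le_nhds).eventually_lt_const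
      (lt_min one_pos (by positivity))
  filter_upwards [e1, e2, self_mem_nhdsWithin] with ε h1 h2 hε r
  have hε : 0 < ε := hε
  have hδ1 := h1.trans_le (min_le_left _ _)
  have hδ2 := h1.trans_le (min_le_right _ _)
  have hε1 := h2.trans_le (min_le_left _ _)
  have hε2 := h2.trans_le (min_le_right _ _)
  rw [lt_div_iff₀ (by positivity)] at hε2
  have hKε : 4 * M * C * ε < m := by nlinarith
  have hKε0 : 0 ≤ 4 * M * C / m * ε := by positivity
  have h21 : Real.exp (-2 / ε) ≤ Real.exp (-1 / ε) := by
    apply Real.exp_le_exp.2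
    exact div_le_div_of_nonneg_right (by norm_num) hε.le
  rcases lt_or_ge r (R - Real.exp (-1 / ε)) with hr | hr
  · have e : rsF R b ε =ᶠ[nhds r] b := by
      filter_upwards [Iio_mem_nhds hr] with x hx
      exact rsF_left hε (le_of_lt hx)
    obtain ⟨d1, d2⟩ := rs_it2 e (Eventually.of_forall hbd) (hbd2 r)
    have hp := hbpos r
    have hq : c ^ 2 * b r / b r = c ^ 2 := by field_simp
    rw [d1, d2, e.eq_of_nhds, hq]
    refine ⟨hp, by positivity, by positivity, by linarith, fun _ => rfl⟩
  rcases lt_or_ge (R - Real.exp (-2 / ε)) r with hr2 | hr2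
  · have e : rsF R b ε =ᶠ[nhds r] Real.sinh := by
      filter_upwards [Ioi_mem_nhds hr2] with x hx
      exact rsF_right hε (le_of_lt hx)
    obtain ⟨d1, d2⟩ := rs_it2 e (Eventually.of_forall Real.hasDerivAt_sinh)
      (Real.hasDerivAt_cosh r)
    have hp : 0 < Real.sinh r := Real.sinh_pos_iff.2 (by linarith)
    rw [d1, d2, e.eq_of_nhds, div_self hp.ne']
    exact ⟨hp, Real.cosh_pos r, hp, by linarith, fun h => absurd h (not_lt.2 hr)⟩
  have hrR : r < R := by linarith [Real.exp_pos (-2 / ε)]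
  have e : rsF R b ε =ᶠ[nhds r] fun r => b r + rsP R ε r * (Real.sinh r - b r) := by
    filter_upwards [Iio_mem_nhds hrR] with x hx
    simp [rsF, mem_Iio.1 hx]
  obtain ⟨d1, d2⟩ := rs_it2 (F1 := fun x => c * b x + (rsP1 R ε x * (Real.sinh x - b x) +
      rsP R ε x * (Real.cosh x - c * b x))) e
    (by
      filter_upwards [Iio_mem_nhds hrR] with x hx
      exact (hbd x).add ((rsP_deriv hx).mul ((Real.hasDerivAt_sinh x).sub (hbd x))))
    ((hbd2 r).add (((rsP1_deriv hrR).mul ((Real.hasDerivAt_sinh r).sub (hbd r))).add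
      ((rsP_deriv hrR).mul ((Real.hasDerivAt_cosh r).sub (hbd2 r)))))
  simp only [Pi.sub_apply] at d2
  have hT : rsT R ε r ∈ Icc (0 : ℝ) 1 := ⟨rsT_nonneg hε hrR hr, rsT_le_one hε hr2⟩
  obtain ⟨b1, b2⟩ := hg r ⟨by linarith, hrR.le⟩
  obtain ⟨E1, E2⟩ := rs_mid (x := R - r) (by linarith) (by linarith) hε hε1.le hM hC
    (hS _ hT).1 (hS _ hT).2 b1 b2
  have hp0 : 0 ≤ rsP R ε r := Real.smoothTransition.nonneg _
  have hp1 : rsP R ε r ≤ 1 := Real.smoothTransition.le_one _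
  have mb := hmb r (by linarith)
  have ms := hms r (by linarith)
  have mc : m ≤ Real.cosh r := ms.trans (Real.sinh_lt_cosh r).le
  have mb1 : m ≤ c * b r := by nlinarith
  have mb2 : m ≤ c ^ 2 * b r := by nlinarith
  have k0 := rs_convex hp0 hp1 mb ms
  have k1 := rs_convex hp0 hp1 mb1 mc
  have k2 := rs_convex hp0 hp1 mb2 ms
  rw [abs_le] at E1 E2
  change _ ≤ rsP1 R ε r * _ ∧ rsP1 R ε r * _ ≤ _ at E1
  change _ ≤ rsP2 R ε r * _ + 2 * (rsP1 R ε r * _) ∧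
    rsP2 R ε r * _ + 2 * (rsP1 R ε r * _) ≤ _ at E2
  rw [d1, d2, e.eq_of_nhds]
  have hpos : 0 < b r + rsP R ε r * (Real.sinh r - b r) := by linarith
  refine ⟨hpos, by linarith [E1.1], by linarith [E2.1], ?_, fun h => absurd h (not_lt.2 hr)⟩
  rw [div_le_iff₀ hpos]
  have q1 : 4 * M * C * ε ≤ 4 * M * C / m * ε * (b r + rsP R ε r * (Real.sinh r - b r)) := by
    calc 4 * M * C * ε = 4 * M * C / m * ε * m := by field_simp
      _ ≤ _ := mul_le_mul_of_nonneg_left k0 hKε0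
  have q2 : rsP R ε r * Real.sinh r ≤ c ^ 2 * (rsP R ε r * Real.sinh r) := by
    have : 0 ≤ rsP R ε r * Real.sinh r := mul_nonneg hp0 (by linarith)
    exact le_mul_of_one_le_left this hc2
  linarith [E2.2]

/-- Smoothing the radial tube-metric coefficient: smooth functions `f_ε` gluing
`b(r) = sinh R · exp(coth R (r-R))` to `sinh`, eventually positive and convex, with
`sup f_ε″/f_ε → coth² R`. -/
theorem radial_smoothing (R : ℝ) (hR : 0 < R) (b : ℝ → ℝ)
    (hb : ∀ r, b r = Real.sinh R * Real.exp (coth R * (r - R))) :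
    ∃ (fε : ℝ → ℝ → ℝ) (δ : ℝ → ℝ),
      (∀ ε > 0, 0 < δ ε) ∧
      Tendsto δ (nhdsWithin 0 (Ioi 0)) (nhds 0) ∧
      (∀ ε > 0, ContDiff ℝ (⊤ : ℕ∞) (fε ε) ∧
        (∀ r ≤ R - δ ε, fε ε r = b r) ∧
        (∀ r ≥ R, fε ε r = Real.sinh r)) ∧
      (∀ᶠ ε in nhdsWithin 0 (Ioi 0), ∀ r : ℝ,
        0 < fε ε r ∧ 0 < deriv (fε ε) r ∧ 0 < iteratedDeriv 2 (fε ε) r) ∧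
      Tendsto (fun ε => ⨆ r : ℝ, iteratedDeriv 2 (fε ε) r / fε ε r)
        (nhdsWithin 0 (Ioi 0)) (nhds (coth R ^ 2)) := by
  have hbs : ContDiff ℝ (⊤ : ℕ∞) b := by
    rw [show b = fun r => Real.sinh R * Real.exp (coth R * (r - R)) from funext hb]
    fun_prop
  obtain ⟨K, hK, hkey⟩ := rs_key R hR b hb
  refine ⟨rsF R b, fun ε => Real.exp (-1 / ε), fun ε _ => Real.exp_pos _, rs_delta_tendsto,
    fun ε hε => ⟨rsF_contDiff hε hbs, fun r hr => rsF_left hε hr, fun r hr => ?_⟩,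
    hkey.mono fun ε h r => ⟨(h r).1, (h r).2.1, (h r).2.2.1⟩, ?_⟩
  · exact rsF_right hε (by linarith [Real.exp_pos (-2 / ε)])
  have hlim : Tendsto (fun ε : ℝ => coth R ^ 2 + K * ε) (nhdsWithin 0 (Ioi 0))
      (nhds (coth R ^ 2)) := by
    have : Tendsto (fun ε : ℝ => coth R ^ 2 + K * ε) (nhds 0) (nhds (coth R ^ 2 + K * 0)) :=
      Continuous.tendsto (by fun_prop) 0
    rw [mul_zero, add_zero] at this
    exact this.mono_left nhdsWithin_le_nhds
  refine tendsto_of_tendsto_of_tendsto_of_le_of_le' tendsto_const_nhds hlim ?_ ?_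
  · filter_upwards [hkey] with ε h
    rw [← (h (R - Real.exp (-1 / ε) - 1)).2.2.2.2 (by linarith)]
    refine le_ciSup (f := fun r => iteratedDeriv 2 (rsF R b ε) r / rsF R b ε r) ?_ _
    exact ⟨coth R ^ 2 + K * ε, by rintro _ ⟨r, rfl⟩; exact (h r).2.2.2.1⟩
  · filter_upwards [hkey] with ε h
    exact ciSup_le fun r => (h r).2.2.2.1
end

section
/- Let R > 0 and let b(r) = cosh(R)·exp(tanh(R)·(r − R)). Then for every ε > 0 there exist a C^∞ function g_ε : ℝ → ℝ and δ(ε) > 0 with δ(ε) → 0 as ε → 0⁺, such that g_ε(r) = b(r) for r ≤ R − δ(ε), g_ε(r) = cosh(r) for r ≥ R, g_ε(r) > 0, g_ε′(r) > 0 and g_ε″(r) > 0 for all r (for all sufficiently small ε), and sup_{r ∈ ℝ} g_ε″(r)/g_ε(r) → 1 as ε → 0⁺. -/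
open Filter Set

/-- The smoothing: a logarithmic cutoff between `b` and `cosh`. -/
noncomputable def glueFun (R : ℝ) (b : ℝ → ℝ) (ε r : ℝ) : ℝ :=
  if r < R then b r + Real.smoothTransition (-ε * Real.log ((R - r) / ε)) * (Real.cosh r - b r)
  else Real.cosh r

lemma smoothTransition_bounds : ∃ K : ℝ, 0 < K ∧ ∀ t : ℝ,
    |deriv Real.smoothTransition t| ≤ K ∧ |deriv (deriv Real.smoothTransition) t| ≤ K := by
  have hS : ContDiff ℝ 2 Real.smoothTransition := Real.smoothTransition.contDiff
  have hS1 : ContDiff ℝ 1 (deriv Real.smoothTransition) := by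
    have : ContDiff ℝ (1 + 1) Real.smoothTransition := by
      simpa [one_add_one_eq_two] using hS
    exact (contDiff_succ_iff_deriv.1 this).2.2
  have hc1 : Continuous (deriv Real.smoothTransition) := hS1.continuous
  have hc2 : Continuous (deriv (deriv Real.smoothTransition)) := hS1.continuous_deriv le_rfl
  obtain ⟨K1, h1⟩ := (isCompact_Icc (a := (0 : ℝ)) (b := 1)).exists_bound_of_continuousOn
    hc1.continuousOn
  obtain ⟨K2, h2⟩ := (isCompact_Icc (a := (0 : ℝ)) (b := 1)).exists_bound_of_continuousOn
    hc2.continuousOn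
  have hK : 0 < |K1| + |K2| + 1 := by positivity
  refine ⟨|K1| + |K2| + 1, hK, fun t => ?_⟩
  have aux : ∀ c : ℝ, Real.smoothTransition =ᶠ[nhds t] (fun _ => c) →
      |deriv Real.smoothTransition t| ≤ |K1| + |K2| + 1 ∧
      |deriv (deriv Real.smoothTransition) t| ≤ |K1| + |K2| + 1 := by
    intro c h
    have e1 := h.deriv
    have e2 := e1.deriv_eq
    have e3 := e1.eq_of_nhds
    rw [e2, e3]
    simp [hK.le]
  by_cases ht0 : t < 0
  · apply aux 0
    filter_upwards [Iio_mem_nhds ht0] with x hx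
    exact Real.smoothTransition.zero_of_nonpos (le_of_lt hx)
  by_cases ht1 : 1 < t
  · apply aux 1
    filter_upwards [Ioi_mem_nhds ht1] with x hx
    exact Real.smoothTransition.one_of_one_le (le_of_lt hx)
  have ht : t ∈ Icc (0 : ℝ) 1 := ⟨not_lt.1 ht0, not_lt.1 ht1⟩
  have a1 := h1 t ht
  have a2 := h2 t ht
  rw [Real.norm_eq_abs] at a1 a2
  constructor <;> linarith [le_abs_self K1, le_abs_self K2, abs_nonneg K1, abs_nonneg K2]

lemma glueFun_left (R : ℝ) (b : ℝ → ℝ) {ε r : ℝ} (hε : 0 < ε) (hr : r ≤ R - ε) :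
    glueFun R b ε r = b r := by
  have h1 : r < R := by linarith
  have h2 : 0 ≤ Real.log ((R - r) / ε) := by
    apply Real.log_nonneg
    rw [le_div_iff₀ hε]; linarith
  rw [glueFun, if_pos h1, Real.smoothTransition.zero_of_nonpos (by nlinarith)]
  ring

lemma glueFun_right (R : ℝ) (b : ℝ → ℝ) {ε r : ℝ} (hε : 0 < ε)
    (hr : R - ε * Real.exp (-1 / ε) < r) :
    glueFun R b ε r = Real.cosh r := by
  by_cases h1 : r < R
  · have h2 : Real.log ((R - r) / ε) ≤ -1 / ε := by
      rw [Real.log_le_iff_le_exp (div_pos (by linarith) hε), div_le_iff₀ hε]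
      linarith
    have h3 : 1 ≤ -ε * Real.log ((R - r) / ε) := by
      have := mul_le_mul_of_nonneg_left h2 hε.le
      have e : ε * (-1 / ε) = -1 := by field_simp
      linarith
    rw [glueFun, if_pos h1, Real.smoothTransition.one_of_one_le h3]
    ring
  · rw [glueFun, if_neg h1]

lemma glueFun_contDiff (R : ℝ) (b : ℝ → ℝ) (hbs : ContDiff ℝ (⊤ : ℕ∞) b) {ε : ℝ} (hε : 0 < ε) :
    ContDiff ℝ (⊤ : ℕ∞) (glueFun R b ε) := by
  rw [contDiff_iff_contDiffAt]
  intro r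
  by_cases h1 : r < R
  · have e : glueFun R b ε =ᶠ[nhds r] fun r => b r +
        Real.smoothTransition (-ε * Real.log ((R - r) / ε)) * (Real.cosh r - b r) := by
      filter_upwards [Iio_mem_nhds h1] with x hx
      rw [glueFun, if_pos (mem_Iio.1 hx)]
    refine ContDiffAt.congr_of_eventuallyEq ?_ e
    have hne : (R - r) / ε ≠ 0 := (div_pos (by linarith) hε).ne'
    have hL : ContDiffAt ℝ (⊤ : ℕ∞) (fun r => -ε * Real.log ((R - r) / ε)) r := by
      refine contDiffAt_const.mul (ContDiffAt.log ?_ hne)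
      exact (contDiffAt_const.sub contDiffAt_id).div_const ε
    have hS : ContDiffAt ℝ (⊤ : ℕ∞)
        (fun r => Real.smoothTransition (-ε * Real.log ((R - r) / ε))) r :=
      (Real.smoothTransition.contDiffAt (n := (⊤ : ℕ∞))).comp r hL
    exact hbs.contDiffAt.add (hS.mul (Real.contDiff_cosh.contDiffAt.sub hbs.contDiffAt))
  · have e : glueFun R b ε =ᶠ[nhds r] Real.cosh := by
      have : R - ε * Real.exp (-1 / ε) < r := by
        have : 0 < ε * Real.exp (-1 / ε) := by positivity
        linarith
      filter_upwards [Ioi_mem_nhds this] with x hx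
      exact glueFun_right R b hε hx
    exact Real.contDiff_cosh.contDiffAt.congr_of_eventuallyEq e

/-- second derivative formula on the gluing region -/
lemma glueFun_deriv2 (R T : ℝ) (b : ℝ → ℝ) (hbd : ∀ r, HasDerivAt b (T * b r) r)
    {ε r : ℝ} (hε : 0 < ε) (hr : r < R) :
    iteratedDeriv 2 (glueFun R b ε) r =
      T * (T * b r) +
      (((deriv (deriv Real.smoothTransition) (-ε * Real.log ((R - r) / ε)) * (ε / (R - r)))
          * (ε / (R - r)) +
        deriv Real.smoothTransition (-ε * Real.log ((R - r) / ε)) * (ε / (R - r) ^ 2))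
          * (Real.cosh r - b r)
       + deriv Real.smoothTransition (-ε * Real.log ((R - r) / ε)) * (ε / (R - r))
          * (Real.sinh r - T * b r))
      + (deriv Real.smoothTransition (-ε * Real.log ((R - r) / ε)) * (ε / (R - r))
          * (Real.sinh r - T * b r)
        + Real.smoothTransition (-ε * Real.log ((R - r) / ε)) *
          (Real.cosh r - T * (T * b r))) := by
  have hS : ContDiff ℝ 2 Real.smoothTransition := Real.smoothTransition.contDiff
  have hS1 : ContDiff ℝ 1 (deriv Real.smoothTransition) := by
    have : ContDiff ℝ (1 + 1) Real.smoothTransition := by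
      simpa [one_add_one_eq_two] using hS
    exact (contDiff_succ_iff_deriv.1 this).2.2
  have hSd : ∀ t, HasDerivAt Real.smoothTransition (deriv Real.smoothTransition t) t :=
    fun t => (hS.differentiable (by norm_num) t).hasDerivAt
  have hSd2 : ∀ t, HasDerivAt (deriv Real.smoothTransition)
      (deriv (deriv Real.smoothTransition) t) t :=
    fun t => (hS1.differentiable (by norm_num) t).hasDerivAt
  have hRx : ∀ x : ℝ, HasDerivAt (fun x => R - x) (-1) x := fun x => by
    simpa using (hasDerivAt_id x).const_sub R
  have hL : ∀ x < R, HasDerivAt (fun x => -ε * Real.log ((R - x) / ε)) (ε / (R - x)) x := by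
    intro x hx
    have hp : 0 < R - x := by linarith
    have h := (((hRx x).div_const ε).log (div_pos hp hε).ne').const_mul (-ε)
    have e : ε / (R - x) = -ε * (-1 / ε / ((R - x) / ε)) := by
      have := hp.ne'
      field_simp
    rw [e]
    exact h
  have hd1 : ∀ x < R, HasDerivAt (glueFun R b ε)
      (T * b x + (deriv Real.smoothTransition (-ε * Real.log ((R - x) / ε)) * (ε / (R - x))
          * (Real.cosh x - b x)
        + Real.smoothTransition (-ε * Real.log ((R - x) / ε)) *
          (Real.sinh x - T * b x))) x := by
    intro x hx
    have e : glueFun R b ε =ᶠ[nhds x] fun r => b r +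
        Real.smoothTransition (-ε * Real.log ((R - r) / ε)) * (Real.cosh r - b r) := by
      filter_upwards [Iio_mem_nhds hx] with y hy
      rw [glueFun, if_pos (mem_Iio.1 hy)]
    refine HasDerivAt.congr_of_eventuallyEq ?_ e
    have hc : HasDerivAt (fun r => Real.smoothTransition (-ε * Real.log ((R - r) / ε)))
      (deriv (Real.smoothTransition) (-ε * Real.log ((R - x) / ε)) * (ε / (R - x))) x :=
      HasDerivAt.comp (h := fun x => -ε * Real.log ((R - x) / ε)) x
        (hSd (-ε * Real.log ((R - x) / ε))) (hL x hx)
    exact (hbd x).add (hc.mul ((Real.hasDerivAt_cosh x).sub (hbd x)))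
  rw [iteratedDeriv_succ, iteratedDeriv_one]
  have e2 : deriv (glueFun R b ε) =ᶠ[nhds r] fun x =>
      (T * b x + (deriv Real.smoothTransition (-ε * Real.log ((R - x) / ε)) * (ε / (R - x))
          * (Real.cosh x - b x)
        + Real.smoothTransition (-ε * Real.log ((R - x) / ε)) *
          (Real.sinh x - T * b x))) := by
    filter_upwards [Iio_mem_nhds hr] with y hy
    exact (hd1 y hy).deriv
  rw [e2.deriv_eq]
  have hp : R - r ≠ 0 := by linarith
  have hc : HasDerivAt (fun r => Real.smoothTransition (-ε * Real.log ((R - r) / ε)))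
      (deriv (Real.smoothTransition) (-ε * Real.log ((R - r) / ε)) * (ε / (R - r))) r :=
      HasDerivAt.comp (h := fun x => -ε * Real.log ((R - x) / ε)) r
        (hSd (-ε * Real.log ((R - r) / ε))) (hL r hr)
  have hc2 : HasDerivAt (fun r => deriv Real.smoothTransition (-ε * Real.log ((R - r) / ε)))
      (deriv (deriv Real.smoothTransition) (-ε * Real.log ((R - r) / ε)) * (ε / (R - r))) r :=
      HasDerivAt.comp (h := fun x => -ε * Real.log ((R - x) / ε)) r
        (hSd2 (-ε * Real.log ((R - r) / ε))) (hL r hr)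
  have hq : HasDerivAt (fun x => ε / (R - x)) (ε / (R - r) ^ 2) r := by
    have h := (hasDerivAt_const r ε).div (hRx r) hp
    have e : ε / (R - r) ^ 2 = (0 * (R - r) - ε * (-1)) / (R - r) ^ 2 := by ring
    rw [e]
    exact h
  have hfin := ((hbd r).const_mul T).add (((hc2.mul hq).mul ((Real.hasDerivAt_cosh r).sub (hbd r))).add
    (hc.mul ((Real.hasDerivAt_sinh r).sub ((hbd r).const_mul T))))
  rw [add_assoc]
  exact hfin.deriv

lemma h_bounds (R T : ℝ) (b : ℝ → ℝ) (hbd : ∀ r, HasDerivAt b (T * b r) r)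
    (h0 : b R = Real.cosh R) (h1 : T * b R = Real.sinh R) :
    ∃ M : ℝ, 0 < M ∧ ∀ r, R - 1 ≤ r → r ≤ R →
      |Real.sinh r - T * b r| ≤ M * (R - r) ∧ |Real.cosh r - b r| ≤ M * (R - r) ^ 2 := by
  have hbc : Continuous b := continuous_iff_continuousAt.2 fun x => (hbd x).continuousAt
  have hcont : Continuous (fun r => Real.cosh r - T * (T * b r)) := by
    have := Real.continuous_cosh
    fun_prop
  obtain ⟨M, hM⟩ := (isCompact_Icc (a := R - 1) (b := R)).exists_bound_of_continuousOn
    hcont.continuousOn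
  have key : ∀ r, R - 1 ≤ r → r ≤ R → |Real.sinh r - T * b r| ≤ (|M| + 1) * (R - r) := by
    intro r hr1 hr2
    have := (convex_Icc (R - 1) R).norm_image_sub_le_of_norm_hasDerivWithin_le
      (f := fun r => Real.sinh r - T * b r) (f' := fun r => Real.cosh r - T * (T * b r))
      (C := |M| + 1) (x := R) (y := r)
      (fun x _ => ((Real.hasDerivAt_sinh x).sub ((hbd x).const_mul T)).hasDerivWithinAt)
      (fun x hx => (hM x hx).trans (by linarith [le_abs_self M]))
      ⟨by linarith, le_rfl⟩ ⟨hr1, hr2⟩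
    simp only [h1, sub_self, sub_zero, Real.norm_eq_abs] at this
    rwa [abs_sub_comm r R, abs_of_nonneg (by linarith : 0 ≤ R - r)] at this
  refine ⟨|M| + 1, by positivity, fun r hr1 hr2 => ⟨key r hr1 hr2, ?_⟩⟩
  have := (convex_Icc r R).norm_image_sub_le_of_norm_hasDerivWithin_le
      (f := fun r => Real.cosh r - b r) (f' := fun r => Real.sinh r - T * b r)
      (C := (|M| + 1) * (R - r)) (x := R) (y := r)
      (fun x _ => ((Real.hasDerivAt_cosh x).sub (hbd x)).hasDerivWithinAt)
      (fun x hx => (key x (hr1.trans hx.1) hx.2).trans (by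
        have := hx.1
        gcongr))
      ⟨hr2, le_rfl⟩ ⟨le_rfl, hr2⟩
  simp only [h0, sub_self, sub_zero, Real.norm_eq_abs] at this
  rw [abs_sub_comm r R, abs_of_nonneg (by linarith : 0 ≤ R - r)] at this
  linarith

lemma error_bound {K M ε x s1 s2 h h' : ℝ} (hε : 0 < ε) (hε1 : ε < 1) (hx : 0 < x) (hK : 0 < K)
    (hM : 0 < M) (a1 : |s1| ≤ K) (a2 : |s2| ≤ K) (b1 : |h'| ≤ M * x) (b2 : |h| ≤ M * x ^ 2) :
    |((s2 * (ε / x)) * (ε / x) + s1 * (ε / x ^ 2)) * h + s1 * (ε / x) * h' + s1 * (ε / x) * h'|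
      ≤ 4 * K * M * ε := by
  obtain ⟨u, rfl⟩ : ∃ u, h = x ^ 2 * u := ⟨h / x ^ 2, by field_simp⟩
  obtain ⟨v, rfl⟩ : ∃ v, h' = x * v := ⟨h' / x, by field_simp⟩
  have hu : |u| ≤ M := by
    rw [abs_mul, abs_of_pos (by positivity : 0 < x ^ 2)] at b2
    have : 0 < x ^ 2 := by positivity
    nlinarith
  have hv : |v| ≤ M := by
    rw [abs_mul, abs_of_pos hx] at b1
    nlinarith
  have e : ((s2 * (ε / x)) * (ε / x) + s1 * (ε / x ^ 2)) * (x ^ 2 * u) + s1 * (ε / x) * (x * v)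
      + s1 * (ε / x) * (x * v) = ε * (ε * (s2 * u) + s1 * u + s1 * v + s1 * v) := by
    field_simp
  have m : ∀ p q : ℝ, |p| ≤ K → |q| ≤ M → |p * q| ≤ K * M := by
    intro p q hp hq
    rw [abs_mul]
    exact mul_le_mul hp hq (abs_nonneg _) hK.le
  have m1 := m s2 u a2 hu
  have m2 := m s1 u a1 hu
  have m3 := m s1 v a1 hv
  have m0 : |ε * (s2 * u)| ≤ K * M := by
    rw [abs_mul, abs_of_pos hε]
    nlinarith [abs_nonneg (s2 * u)]
  rw [e, abs_mul, abs_of_pos hε]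
  have : |ε * (s2 * u) + s1 * u + s1 * v + s1 * v| ≤ 4 * (K * M) := by
    rw [abs_le] at *
    constructor <;> linarith [m0.1, m0.2, m2.1, m2.2, m3.1, m3.2]
  nlinarith

/-- Smoothing the longitudinal tube-metric coefficient: smooth functions `g_ε` gluing
`b(r) = cosh R · exp(tanh R (r-R))` to `cosh`, eventually positive and convex, with
`sup g_ε″/g_ε → 1`. -/
theorem longitudinal_smoothing (R : ℝ) (hR : 0 < R) (b : ℝ → ℝ)
    (hb : ∀ r, b r = Real.cosh R * Real.exp (Real.tanh R * (r - R))) :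
    ∃ (gε : ℝ → ℝ → ℝ) (δ : ℝ → ℝ),
      (∀ ε > 0, 0 < δ ε) ∧
      Tendsto δ (nhdsWithin 0 (Ioi 0)) (nhds 0) ∧
      (∀ ε > 0, ContDiff ℝ (⊤ : ℕ∞) (gε ε) ∧
        (∀ r ≤ R - δ ε, gε ε r = b r) ∧
        (∀ r ≥ R, gε ε r = Real.cosh r)) ∧
      (∀ᶠ ε in nhdsWithin 0 (Ioi 0), ∀ r : ℝ,
        0 < gε ε r ∧ 0 < deriv (gε ε) r ∧ 0 < iteratedDeriv 2 (gε ε) r) ∧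
      Tendsto (fun ε => ⨆ r : ℝ, iteratedDeriv 2 (gε ε) r / gε ε r)
        (nhdsWithin 0 (Ioi 0)) (nhds 1) := by
  set T := Real.tanh R with hT
  have hT0 : 0 < T := by
    rw [hT, Real.tanh_eq_sinh_div_cosh]
    exact div_pos (Real.sinh_pos_iff.2 hR) (Real.cosh_pos R)
  have hT1 : T < 1 := by
    rw [hT, Real.tanh_eq_sinh_div_cosh, div_lt_one (Real.cosh_pos R)]
    exact Real.sinh_lt_cosh R
  have hbfun : b = fun r => Real.cosh R * Real.exp (T * (r - R)) := funext hb
  have hbs : ContDiff ℝ (⊤ : ℕ∞) b := by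
    rw [hbfun]; fun_prop
  have hbd : ∀ r, HasDerivAt b (T * b r) r := by
    intro r
    have h := (((((hasDerivAt_id r).sub_const R).const_mul T).exp).const_mul (Real.cosh R))
    have e : T * b r = Real.cosh R * (Real.exp (T * (id r - R)) * (T * 1)) := by
      rw [hb, id]; ring
    rw [e, hbfun]
    exact h
  have hbpos : ∀ r, 0 < b r := by
    intro r; rw [hb]; have := Real.cosh_pos R; positivity
  have hbmono : ∀ r, R - 1 ≤ r → b (R - 1) ≤ b r := by
    intro r hr
    rw [hb, hb]
    have := Real.cosh_pos R
    gcongr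
  have h0 : b R = Real.cosh R := by rw [hb]; simp
  have h1 : T * b R = Real.sinh R := by
    rw [h0, hT, Real.tanh_eq_sinh_div_cosh]
    have := (Real.cosh_pos R).ne'
    field_simp
  obtain ⟨K, hK, hKb⟩ := smoothTransition_bounds
  obtain ⟨M, hM, hMb⟩ := h_bounds R T b hbd h0 h1
  set C := 4 * K * M with hC
  have hCpos : 0 < C := by positivity
  obtain ⟨c, hc, hc1, hcb⟩ : ∃ c : ℝ, 0 < c ∧ c ≤ 1 ∧ ∀ r, R - 1 ≤ r → c ≤ T * (T * b r) := by
    refine ⟨min 1 (T * (T * b (R - 1))), ?_, min_le_left _ _, fun r hr => ?_⟩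
    · have := hbpos (R - 1)
      exact lt_min one_pos (by positivity)
    · refine (min_le_right _ _).trans ?_
      have := hbmono r hr
      gcongr
  have hTb : ∀ r, T * (T * b r) ≤ b r := by
    intro r
    have := hbpos r
    have : T * b r ≤ b r := by nlinarith
    nlinarith
  -- local description of the function and of its second derivative
  have desc : ∀ ε, 0 < ε → ε < 1 → ∀ r,
      (r < R - ε ∧ glueFun R b ε r = b r ∧ iteratedDeriv 2 (glueFun R b ε) r = T * (T * b r)) ∨
      (R ≤ r ∧ glueFun R b ε r = Real.cosh r ∧
        iteratedDeriv 2 (glueFun R b ε) r = Real.cosh r) ∨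
      (c ≤ glueFun R b ε r ∧ c - C * ε ≤ iteratedDeriv 2 (glueFun R b ε) r ∧
        iteratedDeriv 2 (glueFun R b ε) r ≤ glueFun R b ε r + C * ε) := by
    intro ε hε hε1 r
    rcases lt_or_ge r (R - ε) with hl | hl
    · left
      refine ⟨hl, glueFun_left R b hε hl.le, ?_⟩
      have e : glueFun R b ε =ᶠ[nhds r] b := by
        filter_upwards [Iio_mem_nhds hl] with x hx
        exact glueFun_left R b hε (le_of_lt hx)
      rw [iteratedDeriv_succ, iteratedDeriv_one, e.deriv.deriv_eq]
      have : deriv b = fun x => T * b x := funext fun x => (hbd x).deriv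
      rw [this]
      exact ((hbd r).const_mul T).deriv
    right
    rcases le_or_gt R r with hr | hr
    · left
      have hlt : R - ε * Real.exp (-1 / ε) < r := by
        have : 0 < ε * Real.exp (-1 / ε) := by positivity
        linarith
      refine ⟨hr, glueFun_right R b hε hlt, ?_⟩
      have e : glueFun R b ε =ᶠ[nhds r] Real.cosh := by
        filter_upwards [Ioi_mem_nhds hlt] with x hx
        exact glueFun_right R b hε hx
      rw [iteratedDeriv_succ, iteratedDeriv_one, e.deriv.deriv_eq, Real.deriv_cosh,
        Real.deriv_sinh]
    right
    have hr1 : R - 1 ≤ r := by linarith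
    have hg : glueFun R b ε r = b r +
        Real.smoothTransition (-ε * Real.log ((R - r) / ε)) * (Real.cosh r - b r) := by
      rw [glueFun, if_pos hr]
    have hd := glueFun_deriv2 R T b hbd hε hr
    obtain ⟨k1, k2⟩ := hKb (-ε * Real.log ((R - r) / ε))
    obtain ⟨m1, m2⟩ := hMb r hr1 hr.le
    have hE := error_bound hε hε1 (by linarith : 0 < R - r) hK hM k1 k2 m1 m2
    rw [← hC, abs_le] at hE
    obtain ⟨E1, E2⟩ := hE
    have χ0 := Real.smoothTransition.nonneg (-ε * Real.log ((R - r) / ε))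
    have χ1 := Real.smoothTransition.le_one (-ε * Real.log ((R - r) / ε))
    rw [hg, hd]
    generalize Real.smoothTransition (-ε * Real.log ((R - r) / ε)) = χ at *
    have q1 := hcb r hr1
    have q2 := hTb r
    have q3 := Real.one_le_cosh r
    have p1 := mul_nonneg χ0 (by linarith : 0 ≤ Real.cosh r - c)
    have p2 := mul_nonneg (sub_nonneg.2 χ1) (by linarith : 0 ≤ b r - c)
    have p3 := mul_nonneg (sub_nonneg.2 χ1) (by linarith : 0 ≤ T * (T * b r) - c)
    have p4 := mul_nonneg (sub_nonneg.2 χ1) (by linarith : 0 ≤ b r - T * (T * b r))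
    refine ⟨by linarith, by linarith, by linarith⟩
  -- positivity of the function and bound on the ratio
  have hpos : ∀ ε, 0 < ε → ε < 1 → ∀ r, 0 < glueFun R b ε r := by
    intro ε hε hε1 r
    rcases desc ε hε hε1 r with ⟨_, h, _⟩ | ⟨_, h, _⟩ | ⟨h, _⟩
    · rw [h]; exact hbpos r
    · rw [h]; exact Real.cosh_pos r
    · linarith
  have hratio : ∀ ε, 0 < ε → ε < 1 → ∀ r,
      iteratedDeriv 2 (glueFun R b ε) r / glueFun R b ε r ≤ 1 + C / c * ε := by
    intro ε hε hε1 r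
    have hp := hpos ε hε hε1 r
    have hn : 0 ≤ C / c * ε := by positivity
    rw [div_le_iff₀ hp]
    rcases desc ε hε hε1 r with ⟨_, h, h'⟩ | ⟨_, h, h'⟩ | ⟨h, _, h'⟩
    · rw [h']; rw [h] at hp ⊢; nlinarith [hTb r]
    · rw [h']; rw [h] at hp ⊢; nlinarith
    · have e : C / c * ε * c = C * ε := by field_simp
      nlinarith
  have hlow : ∀ ε, 0 < ε → ε < 1 → 1 ≤ ⨆ r : ℝ,
      iteratedDeriv 2 (glueFun R b ε) r / glueFun R b ε r := by
    intro ε hε hε1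
    have hbdd : BddAbove (range fun r : ℝ =>
        iteratedDeriv 2 (glueFun R b ε) r / glueFun R b ε r) := by
      refine ⟨1 + C / c * ε, ?_⟩
      rintro _ ⟨r, rfl⟩
      exact hratio ε hε hε1 r
    have hle := le_ciSup hbdd R
    have : iteratedDeriv 2 (glueFun R b ε) R / glueFun R b ε R = 1 := by
      have hlt : R - ε * Real.exp (-1 / ε) < R := by
        have : 0 < ε * Real.exp (-1 / ε) := by positivity
        linarith
      have e : glueFun R b ε =ᶠ[nhds R] Real.cosh := by
        filter_upwards [Ioi_mem_nhds hlt] with x hx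
        exact glueFun_right R b hε hx
      rw [iteratedDeriv_succ, iteratedDeriv_one, e.deriv.deriv_eq, Real.deriv_cosh,
        Real.deriv_sinh, e.eq_of_nhds, div_self (Real.cosh_pos R).ne']
    simpa [this] using hle
  refine ⟨glueFun R b, fun ε => ε, fun ε hε => hε, tendsto_id.mono_left nhdsWithin_le_nhds,
    fun ε hε => ⟨glueFun_contDiff R b hbs hε, fun r hr => glueFun_left R b hε hr, fun r hr => ?_⟩,
    ?_, ?_⟩
  · rw [glueFun, if_neg (not_lt.2 hr)]
  · have hev : ∀ᶠ ε : ℝ in nhdsWithin 0 (Ioi 0), ε ∈ Ioo 0 (min 1 (c / C)) :=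
      Ioo_mem_nhdsGT (lt_min one_pos (by positivity))
    filter_upwards [hev] with ε hε
    obtain ⟨hε0, hε2⟩ := hε
    have hε1 : ε < 1 := hε2.trans_le (min_le_left _ _)
    have hεc : C * ε < c := by
      have := hε2.trans_le (min_le_right _ _)
      rw [lt_div_iff₀ hCpos] at this
      linarith
    have h2 : ∀ r, 0 < iteratedDeriv 2 (glueFun R b ε) r := by
      intro r
      rcases desc ε hε0 hε1 r with ⟨_, _, h⟩ | ⟨_, _, h⟩ | ⟨_, h, _⟩
      · rw [h]; have := hbpos r; positivity
      · rw [h]; exact Real.cosh_pos r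
      · linarith
    have hmono : StrictMono (deriv (glueFun R b ε)) := by
      apply strictMono_of_deriv_pos
      intro x
      have := h2 x
      rwa [iteratedDeriv_succ, iteratedDeriv_one] at this
    intro r
    refine ⟨hpos ε hε0 hε1 r, ?_, h2 r⟩
    have hs1 : min r (R - ε) - 1 < r := by linarith [min_le_left r (R - ε)]
    have hs2 : min r (R - ε) - 1 < R - ε := by linarith [min_le_right r (R - ε)]
    refine lt_trans ?_ (hmono hs1)
    have e : glueFun R b ε =ᶠ[nhds (min r (R - ε) - 1)] b := by
      filter_upwards [Iio_mem_nhds hs2] with x hx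
      exact glueFun_left R b hε0 (le_of_lt hx)
    rw [e.deriv_eq, (hbd _).deriv]
    exact mul_pos hT0 (hbpos _)
  · have hev : ∀ᶠ ε : ℝ in nhdsWithin 0 (Ioi 0), ε ∈ Ioo (0 : ℝ) 1 :=
      Ioo_mem_nhdsGT one_pos
    have hlim : Tendsto (fun ε : ℝ => 1 + C / c * ε) (nhdsWithin 0 (Ioi 0)) (nhds 1) := by
      have : Tendsto (fun ε : ℝ => 1 + C / c * ε) (nhds 0) (nhds (1 + C / c * 0)) :=
        Continuous.tendsto (by fun_prop) 0
      rw [mul_zero, add_zero] at this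
      exact this.mono_left nhdsWithin_le_nhds
    refine tendsto_of_tendsto_of_tendsto_of_le_of_le' tendsto_const_nhds hlim ?_ ?_
    · filter_upwards [hev] with ε hε
      exact hlow ε hε.1 hε.2
    · filter_upwards [hev] with ε hε
      exact ciSup_le (hratio ε hε.1 hε.2)
end
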